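/- Let G be a dense, K_4^3 ∪ e-free 3-graph with λ(G) > √3/18, and let x be an optimum weight vector for G. Then for every vertex v of G, the clique number of the link graph satisfies ω(G_v) ≥ 3 and x_v < 1 − √( (√3/3) · ω(G_v)/(ω(G_v) − 1) ). Moreover, if S is a 4-element subset of V(G) all four of whose triples are edges of G and v ∉ S, then 3 ≤ ω(G_v) ≤ 4; consequently x_v < 0.0694 if ω(G_v) = 3 and x_v < 0.12262 if ω(G_v) = 4. -/

import Mathlib

open Finset

/-- An `r`-uniform hypergraph (r-graph) with vertices drawn from `ℕ`. -/
structure HyperGraph (r : ℕ) where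
  verts : Finset ℕ
  edges : Finset (Finset ℕ)
  edges_sub : ∀ e ∈ edges, e ⊆ verts
  card_eq : ∀ e ∈ edges, e.card = r

/-- A 3-uniform hypergraph (3-graph). -/
abbrev ThreeGraph := HyperGraph 3

/-- A feasible weight vector on `G`: nonnegative weights on the vertices summing to 1. -/
def HyperGraph.IsFeasible {r : ℕ} (G : HyperGraph r) (w : ℕ → ℝ) : Prop :=
  (∀ v ∈ G.verts, 0 ≤ w v) ∧ ∑ v ∈ G.verts, w v = 1

/-- The Lagrangian function `λ(G, w) = Σ_{e ∈ E(G)} Π_{v ∈ e} w v`. -/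
noncomputable def HyperGraph.lagFun {r : ℕ} (G : HyperGraph r) (w : ℕ → ℝ) : ℝ :=
  ∑ e ∈ G.edges, ∏ v ∈ e, w v

/-- The Lagrangian `λ(G)`: the maximum of `λ(G, w)` over feasible weight vectors. -/
noncomputable def HyperGraph.lag {r : ℕ} (G : HyperGraph r) : ℝ :=
  sSup {x : ℝ | ∃ w, G.IsFeasible w ∧ G.lagFun w = x}

/-- `G` contains a copy of `F`: an injection of the vertices of `F` into those of `G`
mapping every edge of `F` to an edge of `G`. -/
def HyperGraph.ContainsCopy {r : ℕ} (G F : HyperGraph r) : Prop :=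
  ∃ f : ℕ → ℕ, Set.InjOn f ↑F.verts ∧ (∀ v ∈ F.verts, f v ∈ G.verts) ∧
    ∀ e ∈ F.edges, e.image f ∈ G.edges

/-- `G` is `F`-free. -/
def HyperGraph.Free {r : ℕ} (G F : HyperGraph r) : Prop := ¬ G.ContainsCopy F

/-- `H` is a subgraph of `G`. -/
def HyperGraph.IsSubgraph {r : ℕ} (H G : HyperGraph r) : Prop :=
  H.verts ⊆ G.verts ∧ H.edges ⊆ G.edges

/-- `G` is dense: every proper subgraph has strictly smaller Lagrangian. -/
def HyperGraph.LagDense {r : ℕ} (G : HyperGraph r) : Prop :=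
  ∀ H : HyperGraph r, H.IsSubgraph G → (H.verts ≠ G.verts ∨ H.edges ≠ G.edges) →
    H.lag < G.lag

/-- The Lagrangian density `π_λ(F) = sup { r! · λ(G) : G is F-free }`. -/
noncomputable def lagDensity {r : ℕ} (F : HyperGraph r) : ℝ :=
  sSup {x : ℝ | ∃ G : HyperGraph r, G.Free F ∧ x = (Nat.factorial r : ℝ) * G.lag}

/-- An optimum weight vector for `G`. -/
def HyperGraph.IsOptimal {r : ℕ} (G : HyperGraph r) (w : ℕ → ℝ) : Prop :=
  G.IsFeasible w ∧ G.lagFun w = G.lag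

/-- `K_4^3 ∪ e`: the disjoint union of the complete 3-graph on `{1,2,3,4}`
and the single edge `{5,6,7}`. -/
def K43e : ThreeGraph where
  verts := {1, 2, 3, 4, 5, 6, 7}
  edges := {{1, 2, 3}, {1, 2, 4}, {1, 3, 4}, {2, 3, 4}, {5, 6, 7}}
  edges_sub := by decide
  card_eq := by decide

/-- The edge set of the link graph `G_v`: the 2-element sets `e \ {v}` for edges
`e` of `G` containing `v`. -/
def linkEdges (G : ThreeGraph) (v : ℕ) : Finset (Finset ℕ) :=
  (G.edges.filter (fun e => v ∈ e)).image (fun e => e.erase v)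

/-- `ω(G_v)`: the number of vertices of a maximum complete subgraph of the link
graph of `v` in `G`. -/
noncomputable def linkCliqueNum (G : ThreeGraph) (v : ℕ) : ℕ :=
  sSup {k | ∃ S : Finset ℕ, S ⊆ G.verts ∧ S.card = k ∧
    ∀ a ∈ S, ∀ b ∈ S, a ≠ b → ({a, b} : Finset ℕ) ∈ linkEdges G v}

/-- Motzkin–Straus quadratic form. -/
noncomputable def msQ (adj : ℕ → ℕ → Prop) (V : Finset ℕ) (x : ℕ → ℝ) : ℝ :=
  open Classical in ∑ a ∈ V, ∑ b ∈ V, if adj a b then x a * x b else 0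

/-- Weighted degree. -/
noncomputable def msL (adj : ℕ → ℕ → Prop) (V : Finset ℕ) (x : ℕ → ℝ) (u : ℕ) : ℝ :=
  open Classical in ∑ b ∈ V, if adj u b then x b else 0

lemma msQ_insert (adj : ℕ → ℕ → Prop) (hs : ∀ a b, adj a b → adj b a) (hi : ∀ a, ¬ adj a a)
    (V : Finset ℕ) (x : ℕ → ℝ) (u : ℕ) (hu : u ∉ V) :
    msQ adj (insert u V) x = msQ adj V x + 2 * x u * msL adj V x u := by
  classical
  unfold msQ msL
  rw [Finset.sum_insert hu, Finset.sum_insert hu]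
  simp only [Finset.sum_insert hu, Finset.sum_add_distrib, hi, if_false]
  have h1 : ∑ b ∈ V, (if adj u b then x u * x b else 0) =
      x u * ∑ b ∈ V, (if adj u b then x b else 0) := by
    rw [Finset.mul_sum]; refine Finset.sum_congr rfl fun b _ => ?_
    split_ifs <;> simp
  have h2 : ∑ b ∈ V, (if adj b u then x b * x u else 0) =
      x u * ∑ b ∈ V, (if adj u b then x b else 0) := by
    rw [Finset.mul_sum]; refine Finset.sum_congr rfl fun b _ => ?_
    by_cases h : adj u b
    · simp [h, hs _ _ h, mul_comm]
    · have : ¬ adj b u := fun h' => h (hs _ _ h')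
      simp [h, this]
  rw [h1, h2]; ring

lemma msQ_congr (adj : ℕ → ℕ → Prop) (V : Finset ℕ) (x y : ℕ → ℝ) (h : ∀ a ∈ V, x a = y a) :
    msQ adj V x = msQ adj V y := by
  classical
  unfold msQ
  refine Finset.sum_congr rfl fun a ha => Finset.sum_congr rfl fun b hb => ?_
  rw [h a ha, h b hb]

lemma msL_congr (adj : ℕ → ℕ → Prop) (V : Finset ℕ) (x y : ℕ → ℝ) (u : ℕ)
    (h : ∀ a ∈ V, x a = y a) :
    msL adj V x u = msL adj V y u := by
  classical
  unfold msL
  refine Finset.sum_congr rfl fun b hb => ?_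
  rw [h b hb]

lemma msL_insert_nonadj (adj : ℕ → ℕ → Prop) (V : Finset ℕ) (x : ℕ → ℝ) (u w : ℕ) (hw : w ∉ V)
    (h : ¬ adj u w) : msL adj (insert w V) x u = msL adj V x u := by
  classical
  unfold msL
  rw [Finset.sum_insert hw]; simp [h]

lemma motzkin_straus (adj : ℕ → ℕ → Prop) (hs : ∀ a b, adj a b → adj b a) (hi : ∀ a, ¬ adj a a)
    (k : ℕ) (hk : 1 ≤ k) (n : ℕ) : ∀ (V : Finset ℕ) (x : ℕ → ℝ), V.card = n →
    (∀ a ∈ V, 0 ≤ x a) →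
    (∀ T ⊆ V, (∀ a ∈ T, ∀ b ∈ T, a ≠ b → adj a b) → T.card ≤ k) →
    msQ adj V x ≤ (1 - 1 / (k : ℝ)) * (∑ a ∈ V, x a) ^ 2 := by
  classical
  induction n with
  | zero =>
    intro V x hV _ _
    have : V = ∅ := Finset.card_eq_zero.mp hV
    subst this
    simp [msQ]
  | succ n ih =>
    intro V x hV hx hcl
    by_cases hc : ∀ a ∈ V, ∀ b ∈ V, a ≠ b → adj a b
    · have hcard := hcl V (Finset.Subset.refl _) hc
      have hQ : msQ adj V x = (∑ a ∈ V, x a) ^ 2 - ∑ a ∈ V, x a ^ 2 := by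
        unfold msQ
        rw [sq, Finset.sum_mul_sum, ← Finset.sum_sub_distrib]
        refine Finset.sum_congr rfl fun a ha => ?_
        have : ∑ b ∈ V, x a * x b = ∑ b ∈ V, ((if adj a b then x a * x b else 0) +
            if b = a then x a ^ 2 else 0) := by
          refine Finset.sum_congr rfl fun b hb => ?_
          by_cases hab : b = a
          · subst hab; simp [hi, sq]
          · simp [hab, hc a ha b hb (Ne.symm hab)]
        rw [this, Finset.sum_add_distrib, Finset.sum_ite_eq' V a]
        simp [ha]
      have hCS : (∑ a ∈ V, x a) ^ 2 ≤ (V.card : ℝ) * ∑ a ∈ V, x a ^ 2 := sq_sum_le_card_mul_sum_sq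
      have hk' : (0 : ℝ) < k := by exact_mod_cast hk
      have h2 : (0:ℝ) ≤ ∑ a ∈ V, x a ^ 2 := Finset.sum_nonneg fun a _ => sq_nonneg _
      have h3 : (∑ a ∈ V, x a) ^ 2 ≤ (k : ℝ) * ∑ a ∈ V, x a ^ 2 :=
        hCS.trans (mul_le_mul_of_nonneg_right (by exact_mod_cast hcard) h2)
      have h4 : (1 / (k:ℝ)) * (∑ a ∈ V, x a) ^ 2 ≤ ∑ a ∈ V, x a ^ 2 := by
        rw [one_div, inv_mul_le_iff₀ hk']; exact h3
      rw [hQ]; linarith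
    · push Not at hc
      obtain ⟨u, hu, w, hw, huw, hna⟩ := hc
      -- symmetric step
      have key : ∀ u w, u ∈ V → w ∈ V → u ≠ w → ¬ adj u w →
          msL adj ((V.erase u).erase w) x u ≤ msL adj ((V.erase u).erase w) x w →
          msQ adj V x ≤ (1 - 1 / (k : ℝ)) * (∑ a ∈ V, x a) ^ 2 := by
        intro u w hu hw huw hna hL
        set W := (V.erase u).erase w with hW
        have hwW : w ∉ W := by simp [hW]
        have huW : u ∉ insert w W := by simp [hW, huw]
        have hV1 : V.erase u = insert w W := by
          rw [hW, Finset.insert_erase]; simp [hw, huw.symm]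
        have hV2 : V = insert u (insert w W) := by rw [← hV1, Finset.insert_erase hu]
        set y : ℕ → ℝ := Function.update x w (x w + x u) with hy
        have hyW : ∀ a ∈ W, x a = y a := by
          intro a ha
          have : a ≠ w := fun h => hwW (h ▸ ha)
          simp [hy, this]
        have hyw : y w = x w + x u := by simp [hy]
        have hI := ih (insert w W) y (by rw [← hV1, Finset.card_erase_of_mem hu, hV]; rfl)
          (by
            intro a ha
            rcases Finset.mem_insert.mp ha with rfl | ha
            · rw [hyw]; exact add_nonneg (hx _ hw) (hx _ hu)
            · rw [← hyW a ha]; exact hx a (by rw [hV2]; simp [ha]))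
          (fun T hT => hcl T (hT.trans (by rw [hV2]; exact Finset.subset_insert _ _)))
        have hsum : ∑ a ∈ V, x a = ∑ a ∈ insert w W, y a := by
          rw [Finset.sum_insert hwW, hV2, Finset.sum_insert huW, Finset.sum_insert hwW, hyw,
            Finset.sum_congr rfl hyW]; ring
        rw [hsum]
        refine le_trans ?_ hI
        rw [msQ_insert adj hs hi W y w hwW, ← msQ_congr adj W x y hyW,
          ← msL_congr adj W x y w hyW, hyw]
        conv_lhs => rw [hV2]
        rw [msQ_insert adj hs hi _ x u huW, msQ_insert adj hs hi W x w hwW,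
          msL_insert_nonadj adj W x u w hwW hna]
        nlinarith [mul_le_mul_of_nonneg_left hL (hx u hu)]
      rcases le_total (msL adj ((V.erase u).erase w) x u) (msL adj ((V.erase u).erase w) x w) with h | h
      · exact key u w hu hw huw hna h
      · refine key w u hw hu huw.symm (fun h' => hna (hs _ _ h')) ?_
        rw [Finset.erase_right_comm]; exact h

/-- Bounded above. -/
lemma lag_bdd (G : ThreeGraph) : BddAbove {z : ℝ | ∃ w, G.IsFeasible w ∧ G.lagFun w = z} := by
  refine ⟨G.edges.card, ?_⟩
  rintro _ ⟨w, ⟨h0, h1⟩, rfl⟩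
  unfold HyperGraph.lagFun
  have : ∀ e ∈ G.edges, ∏ v ∈ e, w v ≤ 1 := by
    intro e he
    refine Finset.prod_le_one (fun v hv => h0 v (G.edges_sub e he hv)) (fun v hv => ?_)
    rw [← h1]
    exact Finset.single_le_sum (f := w) h0 (G.edges_sub e he hv)
  simpa using Finset.sum_le_sum this

lemma le_lag (G : ThreeGraph) (w : ℕ → ℝ) (hw : G.IsFeasible w) : G.lagFun w ≤ G.lag :=
  le_csSup (lag_bdd G) ⟨w, hw, rfl⟩

lemma lagFun_smul (G : ThreeGraph) (w : ℕ → ℝ) (c : ℝ) :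
    G.lagFun (fun v => c * w v) = c ^ 3 * G.lagFun w := by
  unfold HyperGraph.lagFun
  rw [Finset.mul_sum]
  refine Finset.sum_congr rfl fun e he => ?_
  rw [Finset.prod_mul_distrib, Finset.prod_const, G.card_eq e he]

lemma lagFun_le (G : ThreeGraph) (w : ℕ → ℝ) (h0 : ∀ v ∈ G.verts, 0 ≤ w v) (s : ℝ) (hs : 0 < s)
    (h1 : ∑ v ∈ G.verts, w v = s) : G.lagFun w ≤ G.lag * s ^ 3 := by
  have h := le_lag G (fun v => s⁻¹ * w v)
    ⟨fun v hv => mul_nonneg (inv_nonneg.mpr hs.le) (h0 v hv), by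
      rw [← Finset.mul_sum, h1, inv_mul_cancel₀ hs.ne']⟩
  rw [lagFun_smul] at h
  have h3 : 0 < s ^ 3 := by positivity
  calc G.lagFun w = (s⁻¹ ^ 3 * G.lagFun w) * s ^ 3 := by field_simp
    _ ≤ _ := mul_le_mul_of_nonneg_right h h3.le

/-- Link weight. -/
noncomputable def linkW (G : ThreeGraph) (x : ℕ → ℝ) (v : ℕ) : ℝ :=
  ∑ e ∈ G.edges.filter (fun e => v ∈ e), ∏ u ∈ e.erase v, x u

lemma lagFun_update (G : ThreeGraph) (x : ℕ → ℝ) (v : ℕ) (t : ℝ) :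
    G.lagFun (Function.update x v (x v + t)) = G.lagFun x + t * linkW G x v := by
  classical
  unfold HyperGraph.lagFun linkW
  rw [Finset.mul_sum, Finset.sum_filter, ← Finset.sum_add_distrib]
  refine Finset.sum_congr rfl fun e _ => ?_
  by_cases hv : v ∈ e
  · rw [if_pos hv, ← Finset.mul_prod_erase e _ hv, ← Finset.mul_prod_erase e x hv]
    have : ∏ u ∈ e.erase v, Function.update x v (x v + t) u = ∏ u ∈ e.erase v, x u := by
      refine Finset.prod_congr rfl fun u hu => ?_
      rw [Function.update_of_ne (Finset.ne_of_mem_erase hu)]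
    rw [this, Function.update_self]; ring
  · rw [if_neg hv, add_zero]
    refine Finset.prod_congr rfl fun u hu => ?_
    have huv : u ≠ v := fun h => hv (h ▸ hu)
    rw [Function.update_of_ne huv]

lemma opt_pos (G : ThreeGraph) (hdense : G.LagDense) (x : ℕ → ℝ) (hx : G.IsOptimal x)
    (v : ℕ) (hv : v ∈ G.verts) : 0 < x v := by
  classical
  rcases (hx.1.1 v hv).lt_or_eq with h | h
  · exact h
  exfalso
  let H : ThreeGraph :=
    { verts := G.verts.erase v
      edges := G.edges.filter (fun e => v ∉ e)
      edges_sub := by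
        intro e he
        rw [Finset.mem_filter] at he
        exact Finset.subset_erase.mpr ⟨G.edges_sub e he.1, he.2⟩
      card_eq := fun e he => G.card_eq e (Finset.mem_filter.mp he).1 }
  have hlt := hdense H ⟨Finset.erase_subset _ _, Finset.filter_subset _ _⟩
    (Or.inl (fun he => by
      have : v ∈ H.verts := by rw [he]; exact hv
      simp [H] at this))
  have hfe : H.IsFeasible x := by
    refine ⟨fun u hu => hx.1.1 u (Finset.mem_of_mem_erase hu), ?_⟩
    have := Finset.add_sum_erase G.verts x hv
    rw [← h, hx.1.2, zero_add] at this
    exact this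
  have hle := le_lag H x hfe
  have heq : H.lagFun x = G.lagFun x := by
    unfold HyperGraph.lagFun
    change ∑ e ∈ G.edges.filter (fun e => v ∉ e), _ = _
    rw [Finset.sum_filter]
    refine Finset.sum_congr rfl fun e _ => ?_
    split_ifs with h'
    · exact (Finset.prod_eq_zero h' h.symm).symm
    · rfl
  rw [heq, hx.2] at hle
  linarith

lemma linkW_ge (G : ThreeGraph) (hdense : G.LagDense) (hpos : 0 < G.lag)
    (x : ℕ → ℝ) (hx : G.IsOptimal x)
    (v : ℕ) (hv : v ∈ G.verts) : 3 * G.lag ≤ linkW G x v := by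
  classical
  have hxv := opt_pos G hdense x hx v hv
  have main : ∀ s, 0 < s → s ≤ x v → s < 1 → G.lag * (3 - 3 * s) ≤ linkW G x v := by
    intro s hs hsx hs1
    have h := lagFun_le G (Function.update x v (x v + (-s))) (by
      intro u hu
      by_cases huv : u = v
      · subst huv; rw [Function.update_self]; linarith
      · rw [Function.update_of_ne huv]; exact hx.1.1 u hu) (1 - s) (by linarith) (by
      rw [Finset.sum_update_of_mem hv, ← Finset.erase_eq]
      have := Finset.add_sum_erase G.verts x hv
      rw [hx.1.2] at this
      linarith)
    rw [lagFun_update, hx.2] at h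
    have h2 : s * (G.lag * (3 - 3 * s)) ≤ s * linkW G x v := by
      nlinarith [mul_pos hpos (pow_pos hs 3)]
    exact le_of_mul_le_mul_left h2 hs
  by_contra hcon
  push Not at hcon
  set d := 3 * G.lag - linkW G x v with hd
  have hd0 : 0 < d := by linarith
  set s := min (x v) (min (1/2) (d / (6 * G.lag))) with hs
  have h1 : s ≤ x v := min_le_left _ _
  have h2 : s ≤ 1/2 := (min_le_right _ _).trans (min_le_left _ _)
  have h3 : s ≤ d / (6 * G.lag) := (min_le_right _ _).trans (min_le_right _ _)
  have h0 : 0 < s := lt_min hxv (lt_min (by norm_num) (by positivity))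
  have h4 := main s h0 h1 (by linarith)
  rw [le_div_iff₀ (by positivity)] at h3
  nlinarith

/-- Adjacency in the link. -/
def linkAdj (G : ThreeGraph) (v a b : ℕ) : Prop :=
  a ≠ b ∧ a ≠ v ∧ b ≠ v ∧ ({v, a, b} : Finset ℕ) ∈ G.edges

lemma linkAdj_symm (G : ThreeGraph) (v a b : ℕ) (h : linkAdj G v a b) : linkAdj G v b a := by
  obtain ⟨h1, h2, h3, h4⟩ := h
  exact ⟨h1.symm, h3, h2, by rwa [Finset.pair_comm b a]⟩

lemma mem_linkEdges (G : ThreeGraph) (v a b : ℕ) (hab : a ≠ b) :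
    ({a, b} : Finset ℕ) ∈ linkEdges G v ↔ linkAdj G v a b := by
  unfold linkEdges linkAdj
  rw [Finset.mem_image]
  constructor
  · rintro ⟨e, he, h⟩
    rw [Finset.mem_filter] at he
    refine ⟨hab, ?_, ?_, ?_⟩
    · have : a ∈ e.erase v := by rw [h]; simp
      exact Finset.ne_of_mem_erase this
    · have : b ∈ e.erase v := by rw [h]; simp
      exact Finset.ne_of_mem_erase this
    · rw [← h, Finset.insert_erase he.2]; exact he.1
  · rintro ⟨_, h2, h3, h4⟩
    refine ⟨{v, a, b}, Finset.mem_filter.mpr ⟨h4, by simp⟩, ?_⟩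
    rw [Finset.erase_insert]
    simp [h2.symm, h3.symm]

lemma linkW_le (G : ThreeGraph) (x : ℕ → ℝ) (v : ℕ) (U : Finset ℕ)
    (hU : ∀ e ∈ G.edges, v ∈ e → e.erase v ⊆ U) :
    2 * linkW G x v = msQ (linkAdj G v) U x := by
  classical
  unfold msQ linkW
  rw [← Finset.sum_product', ← Finset.sum_filter,
    ← Finset.sum_fiberwise_of_maps_to (s := (U ×ˢ U).filter fun p => linkAdj G v p.1 p.2)
      (t := G.edges.filter (fun e => v ∈ e)) (g := fun p => ({v, p.1, p.2} : Finset ℕ)),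
    Finset.mul_sum]
  · refine Finset.sum_congr rfl fun e he => ?_
    rw [Finset.mem_filter] at he
    have hc : (e.erase v).card = 2 := by rw [Finset.card_erase_of_mem he.2, G.card_eq e he.1]
    obtain ⟨p, q, hpq, hE⟩ := Finset.card_eq_two.mp hc
    have he' : e = {v, p, q} := by rw [← hE, Finset.insert_erase he.2]
    have hpv : p ≠ v := Finset.ne_of_mem_erase (s := e) (by rw [hE]; simp)
    have hqv : q ≠ v := Finset.ne_of_mem_erase (s := e) (by rw [hE]; simp)
    have hsub := hU e he.1 he.2
    have hpU : p ∈ U := hsub (by rw [hE]; simp)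
    have hqU : q ∈ U := hsub (by rw [hE]; simp)
    have hfib : (((U ×ˢ U).filter fun p => linkAdj G v p.1 p.2).filter
        fun p => ({v, p.1, p.2} : Finset ℕ) = e) = {(p, q), (q, p)} := by
      ext ⟨a, b⟩
      simp only [Finset.mem_filter, Finset.mem_product, Finset.mem_insert, Finset.mem_singleton,
        Prod.mk.injEq]
      constructor
      · rintro ⟨⟨_, hab, hav, hbv, _⟩, h⟩
        have ha : a ∈ ({p, q} : Finset ℕ) := by
          rw [← hE, Finset.mem_erase, ← h]; simp [hav]
        have hb : b ∈ ({p, q} : Finset ℕ) := by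
          rw [← hE, Finset.mem_erase, ← h]; simp [hbv]
        simp only [Finset.mem_insert, Finset.mem_singleton] at ha hb
        omega
      · have hadj : linkAdj G v p q := ⟨hpq, hpv, hqv, he' ▸ he.1⟩
        rintro (⟨rfl, rfl⟩ | ⟨rfl, rfl⟩)
        · exact ⟨⟨⟨hpU, hqU⟩, hadj⟩, he'.symm⟩
        · exact ⟨⟨⟨hqU, hpU⟩, linkAdj_symm _ _ _ _ hadj⟩, by rw [he', Finset.pair_comm a b]⟩
    rw [hfib, hE, Finset.prod_pair hpq, Finset.sum_pair (by simp [hpq])]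
    ring
  · rintro ⟨a, b⟩ h
    simp only [Finset.mem_filter] at h ⊢
    exact ⟨h.2.2.2.2, by simp⟩

/-- Main inequality. -/
lemma main_ineq (G : ThreeGraph) (hdense : G.LagDense)
    (hlag : Real.sqrt 3 / 18 < G.lag) (x : ℕ → ℝ) (hx : G.IsOptimal x)
    (v : ℕ) (hv : v ∈ G.verts) (U : Finset ℕ) (hUV : U ⊆ G.verts)
    (hU : ∀ e ∈ G.edges, v ∈ e → e.erase v ⊆ U) (k : ℕ) (hk : 1 ≤ k)
    (hcl : ∀ T ⊆ U, (∀ a ∈ T, ∀ b ∈ T, a ≠ b → linkAdj G v a b) → T.card ≤ k) :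
    Real.sqrt 3 / 3 < (1 - 1 / (k : ℝ)) * (∑ a ∈ U, x a) ^ 2 := by
  have hpos : 0 < G.lag := lt_of_le_of_lt (by positivity) hlag
  have h1 := linkW_ge G hdense hpos x hx v hv
  have h2 := linkW_le G x v U hU
  have h3 := motzkin_straus (linkAdj G v) (linkAdj_symm G v) (fun a h => h.1 rfl) k hk U.card U x rfl
    (fun a ha => hx.1.1 a (hUV ha)) hcl
  linarith

lemma clique_set_bdd (G : ThreeGraph) (v : ℕ) : BddAbove {k | ∃ S : Finset ℕ, S ⊆ G.verts ∧ S.card = k ∧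
    ∀ a ∈ S, ∀ b ∈ S, a ≠ b → ({a, b} : Finset ℕ) ∈ linkEdges G v} := by
  refine ⟨G.verts.card, ?_⟩
  rintro _ ⟨S, hS, rfl, _⟩
  exact Finset.card_le_card hS

lemma le_cliqueNum (G : ThreeGraph) (v : ℕ) (T : Finset ℕ) (hT : T ⊆ G.verts)
    (h : ∀ a ∈ T, ∀ b ∈ T, a ≠ b → linkAdj G v a b) : T.card ≤ linkCliqueNum G v :=
  le_csSup (clique_set_bdd G v) ⟨T, hT, rfl, fun a ha b hb hab =>
    (mem_linkEdges G v a b hab).mpr (h a ha b hb hab)⟩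

lemma exists_clique (G : ThreeGraph) (v : ℕ) : ∃ T : Finset ℕ, T ⊆ G.verts ∧
    T.card = linkCliqueNum G v ∧ ∀ a ∈ T, ∀ b ∈ T, a ≠ b → linkAdj G v a b := by
  have h := Nat.sSup_mem (s := {k | ∃ S : Finset ℕ, S ⊆ G.verts ∧ S.card = k ∧
    ∀ a ∈ S, ∀ b ∈ S, a ≠ b → ({a, b} : Finset ℕ) ∈ linkEdges G v}) ⟨0, ∅, by simp⟩
    (clique_set_bdd G v)
  obtain ⟨S, h1, h2, h3⟩ := h
  exact ⟨S, h1, h2, fun a ha b hb hab => (mem_linkEdges G v a b hab).mp (h3 a ha b hb hab)⟩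

lemma one_le_cliqueNum (G : ThreeGraph) (v : ℕ) (hv : v ∈ G.verts) : 1 ≤ linkCliqueNum G v := by
  have := le_cliqueNum G v {v} (by simpa using hv) (by
    intro a ha b hb hab
    simp only [Finset.mem_singleton] at ha hb
    exact absurd (ha.trans hb.symm) hab)
  simpa using this

lemma sqrt3_bounds : (1.7320508 : ℝ) < Real.sqrt 3 ∧ Real.sqrt 3 < 1.7320509 := by
  constructor
  · exact Real.lt_sqrt_of_sq_lt (by norm_num)
  · rw [Real.sqrt_lt' (by norm_num)]; norm_num

lemma part_ineq (G : ThreeGraph) (hdense : G.LagDense)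
    (hlag : Real.sqrt 3 / 18 < G.lag) (x : ℕ → ℝ) (hx : G.IsOptimal x)
    (v : ℕ) (hv : v ∈ G.verts) :
    Real.sqrt 3 / 3 < (1 - 1 / (linkCliqueNum G v : ℝ)) * (1 - x v) ^ 2 ∧ 0 < x v ∧ x v ≤ 1 := by
  have h := main_ineq G hdense hlag x hx v hv (G.verts.erase v) (Finset.erase_subset _ _)
    (fun e he _ => Finset.erase_subset_erase v (G.edges_sub e he))
    (linkCliqueNum G v) (one_le_cliqueNum G v hv)
    (fun T hT hc => le_cliqueNum G v T (hT.trans (Finset.erase_subset _ _)) hc)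
  have hs := Finset.add_sum_erase G.verts x hv
  rw [hx.1.2] at hs
  have : ∑ a ∈ G.verts.erase v, x a = 1 - x v := by linarith
  rw [this] at h
  refine ⟨h, opt_pos G hdense x hx v hv, ?_⟩
  rw [← hx.1.2]
  exact Finset.single_le_sum (f := x) hx.1.1 hv

lemma part1 (G : ThreeGraph) (hdense : G.LagDense)
    (hlag : Real.sqrt 3 / 18 < G.lag) (x : ℕ → ℝ) (hx : G.IsOptimal x)
    (v : ℕ) (hv : v ∈ G.verts) : 3 ≤ linkCliqueNum G v ∧
      x v < 1 - Real.sqrt ((Real.sqrt 3 / 3) *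
        ((linkCliqueNum G v : ℝ) / ((linkCliqueNum G v : ℝ) - 1))) := by
  obtain ⟨h, h0, h1⟩ := part_ineq G hdense hlag x hx v hv
  have hk := one_le_cliqueNum G v hv
  obtain ⟨hq1, hq2⟩ := sqrt3_bounds
  set k := linkCliqueNum G v
  have hsq : (1 - x v) ^ 2 ≤ 1 := by nlinarith
  have h3 : 3 ≤ k := by
    by_contra hcon
    have : k = 1 ∨ k = 2 := by omega
    rcases this with hk' | hk' <;> rw [hk'] at h <;> norm_num at h <;> linarith
  refine ⟨h3, ?_⟩
  have hk3 : (3 : ℝ) ≤ k := by exact_mod_cast h3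
  have hx1 : 0 < 1 - x v := by
    rcases (sub_nonneg.mpr h1).lt_or_eq with h' | h'
    · exact h'
    · rw [← h'] at h; norm_num at h; linarith
  have : Real.sqrt ((Real.sqrt 3 / 3) * ((k : ℝ) / ((k : ℝ) - 1))) < 1 - x v := by
    rw [Real.sqrt_lt' hx1, ← mul_div_assoc, div_lt_iff₀ (by linarith)]
    have h5 := mul_lt_mul_of_pos_right h (show (0:ℝ) < k by linarith)
    have h6 : (1 - 1 / (k : ℝ)) * (1 - x v) ^ 2 * k = (1 - x v) ^ 2 * (k - 1) := by
      field_simp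
    linarith
  linarith

set_option maxHeartbeats 2000000 in
lemma edge_meets (G : ThreeGraph) (hfree : G.Free K43e) (S : Finset ℕ) (hS : S ⊆ G.verts)
    (hc : S.card = 4) (hE : ∀ e ⊆ S, e.card = 3 → e ∈ G.edges) (e : Finset ℕ) (he : e ∈ G.edges) :
    ∃ a ∈ e, a ∈ S := by
  by_contra hcon
  push Not at hcon
  apply hfree
  obtain ⟨p, q, r, hpq, hpr, hqr, rfl⟩ := Finset.card_eq_three.mp (G.card_eq e he)
  obtain ⟨a, T, haT, rfl, hT⟩ := Finset.card_eq_succ.mp hc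
  obtain ⟨b, c, d, hbc, hbd, hcd, rfl⟩ := Finset.card_eq_three.mp hT
  have hev := G.edges_sub _ he
  simp only [Finset.insert_subset_iff, Finset.singleton_subset_iff] at hS hev
  simp only [Finset.mem_insert, Finset.mem_singleton, forall_eq_or_imp, forall_eq, not_or] at hcon haT
  obtain ⟨hab, hac, had⟩ := haT
  let f : ℕ → ℕ := fun n => if n = 1 then a else if n = 2 then b else if n = 3 then c else
    if n = 4 then d else if n = 5 then p else if n = 6 then q else r
  refine ⟨f, ?_, ?_, ?_⟩
  · intro i hi j hj hij
    simp only [K43e, Finset.coe_insert, Finset.coe_singleton, Set.mem_insert_iff,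
      Set.mem_singleton_iff] at hi hj
    rcases hi with rfl | rfl | rfl | rfl | rfl | rfl | rfl <;>
    rcases hj with rfl | rfl | rfl | rfl | rfl | rfl | rfl <;>
    first
      | rfl
      | (exfalso; simp [f] at hij; omega)
  · intro i hi
    simp only [K43e, Finset.mem_insert, Finset.mem_singleton] at hi
    rcases hi with rfl | rfl | rfl | rfl | rfl | rfl | rfl <;> simp [f, hS, hev]
  · intro e' he'
    simp only [K43e, Finset.mem_insert, Finset.mem_singleton] at he'
    rcases he' with rfl | rfl | rfl | rfl | rfl
    · refine hE _ ?_ (Finset.card_eq_three.mpr ⟨a, b, c, hab, hac, hbc, by simp [f, Finset.image_insert]⟩)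
      intro z; simp [f]; tauto
    · refine hE _ ?_ (Finset.card_eq_three.mpr ⟨a, b, d, hab, had, hbd, by simp [f, Finset.image_insert]⟩)
      intro z; simp [f]; tauto
    · refine hE _ ?_ (Finset.card_eq_three.mpr ⟨a, c, d, hac, had, hcd, by simp [f, Finset.image_insert]⟩)
      intro z; simp [f]; tauto
    · refine hE _ ?_ (Finset.card_eq_three.mpr ⟨b, c, d, hbc, hbd, hcd, by simp [f, Finset.image_insert]⟩)
      intro z; simp [f]; tauto
    · simpa [f, Finset.image_insert] using he

lemma no_K5 (G : ThreeGraph) (hdense : G.LagDense) (hfree : G.Free K43e)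
    (hlag : Real.sqrt 3 / 18 < G.lag) (x : ℕ → ℝ) (hx : G.IsOptimal x)
    (P : Finset ℕ) (hP : P ⊆ G.verts) (hc : P.card = 5)
    (hE : ∀ e ⊆ P, e.card = 3 → e ∈ G.edges) : False := by
  classical
  obtain ⟨hq1, hq2⟩ := sqrt3_bounds
  -- every edge has at most one vertex outside `P`
  have hout : ∀ e ∈ G.edges, ∀ a ∈ e, ∀ b ∈ e, a ∉ P → b ∉ P → a = b := by
    intro e he a ha b hb haP hbP
    by_contra hab
    have h1 : ((e.erase a).erase b).card = 1 := by
      rw [Finset.card_erase_of_mem (by simp [hb, Ne.symm hab]), Finset.card_erase_of_mem ha,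
        G.card_eq e he]
    obtain ⟨c, hc'⟩ := Finset.card_eq_one.mp h1
    have hsub : ∃ S ⊆ P.erase c, S.card = 4 := by
      apply Finset.exists_subset_card_eq
      have := Finset.pred_card_le_card_erase (s := P) (a := c)
      omega
    obtain ⟨S, hSP, hS4⟩ := hsub
    have hSP' : S ⊆ P := hSP.trans (Finset.erase_subset _ _)
    obtain ⟨z, hz, hzS⟩ := edge_meets G hfree S (hSP'.trans hP) hS4
      (fun e he h3 => hE e (he.trans hSP') h3) e he
    have hza : z ≠ a := fun h => haP (h ▸ hSP' hzS)
    have hzb : z ≠ b := fun h => hbP (h ▸ hSP' hzS)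
    have : z ∈ (e.erase a).erase b := by simp [hz, hza, hzb]
    rw [hc', Finset.mem_singleton] at this
    have h2 := hSP hzS
    rw [this] at h2
    simp at h2
  have hsmall : ∀ u ∈ P, x u < 0.1506 := by
    intro u hu
    have hcl : linkCliqueNum G u ≤ 5 := by
      obtain ⟨T, hT, hTc, hTa⟩ := exists_clique G u
      by_contra hcon
      have hTu : u ∉ T := by
        intro huT
        obtain ⟨b, hb, hbu⟩ := Finset.exists_mem_ne (s := T) (by omega) u
        exact (hTa b hb u huT hbu).2.2.1 rfl
      have h1 : (T \ P).card ≤ 1 := by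
        rw [Finset.card_le_one]
        intro a ha b hb
        rw [Finset.mem_sdiff] at ha hb
        by_contra hab
        have := hTa a ha.1 b hb.1 hab
        exact hab (hout _ this.2.2.2 a (by simp) b (by simp) ha.2 hb.2)
      have h2 : (T ∩ P).card ≤ (P.erase u).card := by
        apply Finset.card_le_card
        intro z hz
        rw [Finset.mem_inter] at hz
        exact Finset.mem_erase.mpr ⟨fun h => hTu (h ▸ hz.1), hz.2⟩
      rw [Finset.card_erase_of_mem hu, hc] at h2
      have := Finset.card_sdiff_add_card_inter T P
      omega
    obtain ⟨h, h0, h1⟩ := part_ineq G hdense hlag x hx u (hP hu)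
    have hk := one_le_cliqueNum G u (hP hu)
    have hk' : (0:ℝ) < linkCliqueNum G u := by exact_mod_cast hk
    have h5 : (1:ℝ) / 5 ≤ 1 / (linkCliqueNum G u : ℝ) :=
      one_div_le_one_div_of_le hk' (by exact_mod_cast hcl)
    by_contra hcon
    push Not at hcon
    have h6 : (1 - x u) ^ 2 ≤ 0.8494 ^ 2 := by
      apply pow_le_pow_left₀ <;> linarith
    have h7 : (1 - 1 / (linkCliqueNum G u : ℝ)) * (1 - x u) ^ 2 ≤ (4/5) * (1 - x u) ^ 2 :=
      mul_le_mul_of_nonneg_right (by linarith) (sq_nonneg _)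
    norm_num at h6
    linarith
  have hpsum : ∑ u ∈ P, x u ≤ 0.753 := by
    have := Finset.sum_le_card_nsmul P x 0.1506 (fun u hu => (hsmall u hu).le)
    rw [hc] at this
    norm_num at this ⊢
    linarith
  by_cases hex : ∃ b ∈ G.verts, b ∉ P
  · obtain ⟨b, hb, hbP⟩ := hex
    have h := main_ineq G hdense hlag x hx b hb P hP (by
      intro e he hbe a ha
      rw [Finset.mem_erase] at ha
      by_contra haP
      exact ha.1 (hout e he a ha.2 b hbe haP hbP)) 5 (by norm_num)
      (fun T hT _ => hc ▸ Finset.card_le_card hT)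
    have h0 : 0 ≤ ∑ u ∈ P, x u := Finset.sum_nonneg fun u hu => hx.1.1 u (hP hu)
    have h6 : (∑ u ∈ P, x u) ^ 2 ≤ 0.753 ^ 2 := pow_le_pow_left₀ h0 hpsum 2
    norm_num at h h6
    linarith
  · push Not at hex
    have : P = G.verts := Finset.Subset.antisymm hP hex
    rw [this, hx.1.2] at hpsum
    norm_num at hpsum

lemma clique_le_four (G : ThreeGraph) (hdense : G.LagDense) (hfree : G.Free K43e)
    (hlag : Real.sqrt 3 / 18 < G.lag) (x : ℕ → ℝ) (hx : G.IsOptimal x)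
    (v : ℕ) (hv : v ∈ G.verts) (S : Finset ℕ) (hS : S ⊆ G.verts) (hc : S.card = 4)
    (hE : ∀ e ⊆ S, e.card = 3 → e ∈ G.edges) (hvS : v ∉ S) : linkCliqueNum G v ≤ 4 := by
  classical
  obtain ⟨T, hT, hTc, hTa⟩ := exists_clique G v
  by_contra hcon
  have h1 : (T \ S).card ≤ 1 := by
    rw [Finset.card_le_one]
    intro a ha b hb
    rw [Finset.mem_sdiff] at ha hb
    by_contra hab
    have := hTa a ha.1 b hb.1 hab
    obtain ⟨z, hz, hzS⟩ := edge_meets G hfree S hS hc hE _ this.2.2.2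
    simp only [Finset.mem_insert, Finset.mem_singleton] at hz
    rcases hz with rfl | rfl | rfl
    · exact hvS hzS
    · exact ha.2 hzS
    · exact hb.2 hzS
  have h2 := Finset.card_sdiff_add_card_inter T S
  have h3 : T ∩ S = S := Finset.eq_of_subset_of_card_le Finset.inter_subset_right (by omega)
  have hST : S ⊆ T := Finset.inter_eq_right.mp h3
  refine no_K5 G hdense hfree hlag x hx (insert v S) (Finset.insert_subset hv hS)
    (by rw [Finset.card_insert_of_notMem hvS, hc]) ?_
  intro e he he3
  by_cases hve : v ∈ e
  · have h2c : (e.erase v).card = 2 := by rw [Finset.card_erase_of_mem hve, he3]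
    obtain ⟨a, b, hab, hE'⟩ := Finset.card_eq_two.mp h2c
    have hsub : e.erase v ⊆ S := by
      intro z hz
      rw [Finset.mem_erase] at hz
      exact (Finset.mem_insert.mp (he hz.2)).resolve_left hz.1
    rw [hE'] at hsub
    have := hTa a (hST (hsub (by simp))) b (hST (hsub (by simp))) hab
    have h4 := this.2.2.2
    rwa [← hE', Finset.insert_erase hve] at h4
  · refine hE e (fun z hz => ?_) he3
    exact (Finset.mem_insert.mp (he hz)).resolve_left (fun h => hve (h ▸ hz))

/-- For a dense `K_4^3 ∪ e`-free 3-graph `G` with `λ(G) > √3/18` and an optimum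
weight vector `x`: every vertex `v` satisfies `ω(G_v) ≥ 3` and
`x v < 1 − √((√3/3)·ω(G_v)/(ω(G_v)−1))`; moreover if `v` lies outside a 4-set of
vertices spanning a complete 3-graph, then `3 ≤ ω(G_v) ≤ 4`, and consequently
`x v < 0.0694` if `ω(G_v) = 3` and `x v < 0.12262` if `ω(G_v) = 4`. -/
theorem clique_bounds (G : ThreeGraph) (hdense : G.LagDense) (hfree : G.Free K43e)
    (hlag : Real.sqrt 3 / 18 < G.lag) (x : ℕ → ℝ) (hx : G.IsOptimal x) :
    (∀ v ∈ G.verts, 3 ≤ linkCliqueNum G v ∧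
      x v < 1 - Real.sqrt ((Real.sqrt 3 / 3) *
        ((linkCliqueNum G v : ℝ) / ((linkCliqueNum G v : ℝ) - 1)))) ∧
    (∀ v ∈ G.verts, ∀ S : Finset ℕ, S ⊆ G.verts → S.card = 4 →
      (∀ e ⊆ S, e.card = 3 → e ∈ G.edges) → v ∉ S →
      3 ≤ linkCliqueNum G v ∧ linkCliqueNum G v ≤ 4 ∧
        (linkCliqueNum G v = 3 → x v < 0.0694) ∧
        (linkCliqueNum G v = 4 → x v < 0.12262)) := by
  refine ⟨fun v hv => part1 G hdense hlag x hx v hv, fun v hv S hS hc hE hvS => ?_⟩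
  obtain ⟨h3, hlt⟩ := part1 G hdense hlag x hx v hv
  obtain ⟨hq1, hq2⟩ := sqrt3_bounds
  refine ⟨h3, clique_le_four G hdense hfree hlag x hx v hv S hS hc hE hvS, ?_, ?_⟩
  · intro hk
    rw [hk] at hlt
    have : (0.9306 : ℝ) < Real.sqrt ((Real.sqrt 3 / 3) * (((3 : ℕ) : ℝ) / (((3 : ℕ) : ℝ) - 1))) := by
      apply Real.lt_sqrt_of_sq_lt
      norm_num
      linarith
    linarith
  · intro hk
    rw [hk] at hlt
    have : (0.87738 : ℝ) < Real.sqrt ((Real.sqrt 3 / 3) * (((4 : ℕ) : ℝ) / (((4 : ℕ) : ℝ) - 1))) := by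
      apply Real.lt_sqrt_of_sq_lt
      norm_num
      linarith
    linarith
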